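/- If α < α_th, then C_{h,σ²}(A, αA) ≤ sup over probability vectors p = (p_1,…,p_n) with ∑_{k=1}^n p_k (k−1) ≤ α of inf over δ > 0, μ > 0 of { (1/2)·log(A² s_n²/(2π e σ²)) − log μ − log(1 − 2Q(δ/σ)) + Q(δ/σ) + (δ/(√(2π) σ))·e^{−δ²/(2σ²)} − ∑_{k=1}^n p_k log(p_k s_n / h_k) + ∑_{k=1}^n p_k · log( e^{μδ/(A h_k)} − e^{−μ(1 + δ/(A h_k))} ) + (μσ/(A√(2π)))·∑_{k=1}^n (p_k/h_k)·( e^{−δ²/(2σ²)} − e^{−(A h_k + δ)²/(2σ²)} ) + μ·( α − ∑_{k=1}^n p_k (k−1) ) }. -/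

import Mathlib

open MeasureTheory ProbabilityTheory Real Filter
open scoped NNReal ENNReal Classical

noncomputable section

/-- Kullback–Leibler divergence (Mathlib's `ProbabilityTheory.klDiv`). -/
def klDiv {α : Type*} [MeasurableSpace α] (μ ν : Measure α) : EReal :=
  if μ ≪ ν ∧ Integrable (llr μ ν) μ then ((∫ x, llr μ ν x ∂μ : ℝ) : EReal) else ⊤

/-- Mutual information of a joint law: KL divergence of the joint law from the
product of its marginals. -/
def mutualInfo {α β : Type*} [MeasurableSpace α] [MeasurableSpace β]
    (joint : Measure (α × β)) : EReal :=
  klDiv joint ((joint.map Prod.fst).prod (joint.map Prod.snd))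

/-- Partial sums `s_k = h_1 + ⋯ + h_k`. -/
def sCum {n : ℕ} (h : Fin n → ℝ) (k : ℕ) : ℝ :=
  ∑ i : Fin n, if i.val < k then h i else 0

/-- Joint law of `(X, Y)` with `Y = hᵀX + Z`, `Z ~ N(0, v)` independent of `X`. -/
def misoJoint {n : ℕ} (h : Fin n → ℝ) (v : ℝ≥0) (μ : Measure (Fin n → ℝ)) :
    Measure ((Fin n → ℝ) × ℝ) :=
  (μ.prod (gaussianReal 0 v)).map (fun p => (p.1, (∑ k, h k * p.1 k) + p.2))

/-- MISO capacity under peak-power constraint `A` and average-power constraint `E`. -/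
def misoCapacity {n : ℕ} (h : Fin n → ℝ) (v : ℝ≥0) (A E : ℝ) : EReal :=
  ⨆ μ ∈ {μ : Measure (Fin n → ℝ) | IsProbabilityMeasure μ ∧
      (∀ k, ∀ᵐ x ∂μ, x k ∈ Set.Icc 0 A) ∧ (∑ k, ∫ x, x k ∂μ) ≤ E},
    mutualInfo (misoJoint h v μ)

/-- MISO capacity under only an average-power constraint `E`. -/
def misoCapacityAvg {n : ℕ} (h : Fin n → ℝ) (v : ℝ≥0) (E : ℝ) : EReal :=
  ⨆ μ ∈ {μ : Measure (Fin n → ℝ) | IsProbabilityMeasure μ ∧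
      (∀ k, ∀ᵐ x ∂μ, 0 ≤ x k) ∧ (∑ k, ∫ x, x k ∂μ) ≤ E},
    mutualInfo (misoJoint h v μ)

/-- Joint law of `(X̄, X̄ + Z)` for the unit-gain SISO channel. -/
def sisoJoint (v : ℝ≥0) (μ : Measure ℝ) : Measure (ℝ × ℝ) :=
  (μ.prod (gaussianReal 0 v)).map (fun p => (p.1, p.1 + p.2))

/-- Unit-gain SISO capacity under peak-power constraint `A` and average-power
constraint `E`. -/
def sisoCapacity (v : ℝ≥0) (A E : ℝ) : EReal :=
  ⨆ μ ∈ {μ : Measure ℝ | IsProbabilityMeasure μ ∧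
      (∀ᵐ x ∂μ, x ∈ Set.Icc 0 A) ∧ (∫ x, x ∂μ) ≤ E},
    mutualInfo (sisoJoint v μ)

/-- Unit-gain SISO capacity under only an average-power constraint `E`. -/
def sisoCapacityAvg (v : ℝ≥0) (E : ℝ) : EReal :=
  ⨆ μ ∈ {μ : Measure ℝ | IsProbabilityMeasure μ ∧
      (∀ᵐ x ∂μ, 0 ≤ x) ∧ (∫ x, x ∂μ) ≤ E},
    mutualInfo (sisoJoint v μ)

/-- The interval `(s_{k-1} A, s_k A]` (with the first one being `[0, s_1 A]`)
corresponding to the event `U = k` (0-indexed: `k ∈ Fin n` stands for `k+1`). -/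
def uInterval {n : ℕ} (h : Fin n → ℝ) (A : ℝ) (k : Fin n) : Set ℝ :=
  if k.val = 0 then Set.Icc 0 (sCum h 1 * A)
  else Set.Ioc (sCum h k.val * A) (sCum h (k.val + 1) * A)

/-- The average input power `∑_k p_k ((E[X̄ | U=k] - A s_{k-1})/h_k + (k-1) A)`
consumed to generate a scalar law of `X̄`. -/
def avgPowerUse {n : ℕ} (h : Fin n → ℝ) (A : ℝ) (μ : Measure ℝ) : ℝ :=
  ∑ k : Fin n,
    (((∫ x in uInterval h A k, x ∂μ) - A * sCum h k.val * (μ (uInterval h A k)).toReal) / h k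
      + (k.val : ℝ) * A * (μ (uInterval h A k)).toReal)

/-- The threshold `α_th`. -/
def alphaTh {n : ℕ} (h : Fin n → ℝ) : ℝ :=
  1 / 2 + (1 / sCum h n) * ∑ k : Fin n, h k * (k.val : ℝ)


/-- The Gaussian Q-function. -/
def gaussQ (x : ℝ) : ℝ :=
  ∫ t in Set.Ioi x, (1 / Real.sqrt (2 * π)) * Real.exp (-t ^ 2 / 2)

/-- The duality-based upper-bound expression of Proposition 7, for a probability
vector `p`, and parameters `δ, m > 0` (noise variance `v = σ²`). -/
def dualityUB {n : ℕ} (h : Fin n → ℝ) (v : ℝ≥0) (A α : ℝ) (p : Fin n → ℝ)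
    (δ m : ℝ) : ℝ :=
  1 / 2 * Real.log (A ^ 2 * (sCum h n) ^ 2 / (2 * π * Real.exp 1 * (v : ℝ)))
    - Real.log m - Real.log (1 - 2 * gaussQ (δ / Real.sqrt v))
    + gaussQ (δ / Real.sqrt v)
    + δ / (Real.sqrt (2 * π) * Real.sqrt v) * Real.exp (-δ ^ 2 / (2 * (v : ℝ)))
    - (∑ k : Fin n, p k * Real.log (p k * sCum h n / h k))
    + (∑ k : Fin n, p k *
        Real.log (Real.exp (m * δ / (A * h k)) - Real.exp (-(m * (1 + δ / (A * h k))))))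
    + m * Real.sqrt v / (A * Real.sqrt (2 * π)) *
        (∑ k : Fin n, p k / h k *
          (Real.exp (-δ ^ 2 / (2 * (v : ℝ))) - Real.exp (-(A * h k + δ) ^ 2 / (2 * (v : ℝ)))))
    + m * (α - ∑ k : Fin n, p k * (k.val : ℝ))

end

section OutputLaw

variable {Ω : Type*} [MeasurableSpace Ω]

/-- The joint law of `(ω, T ω + Z)`, for `ω` distributed as `μ` and `Z` an independent centred
Gaussian of variance `v`. -/
noncomputable def additiveJoint (μ : Measure Ω) (T : Ω → ℝ) (v : ℝ≥0) : Measure (Ω × ℝ) :=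
  (μ.prod (gaussianReal 0 v)).map (fun p => (p.1, T p.1 + p.2))

/-- The density of `T ω + Z`. -/
noncomputable def outputPDF (μ : Measure Ω) (T : Ω → ℝ) (v : ℝ≥0) (y : ℝ) : ℝ≥0∞ :=
  ∫⁻ ω, gaussianPDF (T ω) v y ∂μ

variable {μ : Measure Ω} {T : Ω → ℝ} {v : ℝ≥0}

lemma measurable_channelPDF (hT : Measurable T) :
    Measurable (fun q : Ω × ℝ => gaussianPDF (T q.1) v q.2) := by
  have h := measurable_uncurry_gaussianPDF.comp
    ((hT.comp measurable_fst).prodMk ((measurable_const (a := v)).prodMk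
      (measurable_snd (α := Ω) (β := ℝ))))
  exact h

lemma measurable_outputPDF [SFinite μ] (hT : Measurable T) : Measurable (outputPDF μ T v) :=
  Measurable.lintegral_prod_left' (measurable_channelPDF hT)

lemma measurable_additive (hT : Measurable T) :
    Measurable (fun p : Ω × ℝ => (p.1, T p.1 + p.2)) := by fun_prop

lemma additiveJoint_eq_withDensity [SFinite μ] (hT : Measurable T) (hv : v ≠ 0) :
    additiveJoint μ T v
      = (μ.prod volume).withDensity (fun q => gaussianPDF (T q.1) v q.2) := by
  ext s hs
  have hg := measurable_additive (Ω := Ω) hT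
  rw [additiveJoint, Measure.map_apply hg hs, Measure.prod_apply (hg hs), withDensity_apply _ hs,
    ← lintegral_indicator hs,
    lintegral_prod _ ((measurable_channelPDF hT).indicator hs).aemeasurable]
  refine lintegral_congr fun ω => ?_
  have hs' : MeasurableSet (Prod.mk ω ⁻¹' s) := measurable_prodMk_left hs
  have h1 : (gaussianReal 0 v) (Prod.mk ω ⁻¹' ((fun p : Ω × ℝ => (p.1, T p.1 + p.2)) ⁻¹' s))
      = ((gaussianReal 0 v).map (T ω + ·)) (Prod.mk ω ⁻¹' s) := by
    rw [Measure.map_apply (by fun_prop) hs']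
    rfl
  rw [h1, gaussianReal_map_const_add, zero_add, gaussianReal_apply _ hv, ← lintegral_indicator hs']
  rfl

lemma additiveJoint_map_fst [SFinite μ] (hT : Measurable T) :
    (additiveJoint μ T v).map Prod.fst = μ := by
  rw [additiveJoint, Measure.map_map measurable_fst (measurable_additive hT)]
  have : (Prod.fst ∘ fun p : Ω × ℝ => (p.1, T p.1 + p.2)) = Prod.fst := rfl
  rw [this, Measure.map_fst_prod]
  simp

lemma additiveJoint_map_snd [SFinite μ] (hT : Measurable T) (hv : v ≠ 0) :
    (additiveJoint μ T v).map Prod.snd = volume.withDensity (outputPDF μ T v) := by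
  ext s hs
  rw [additiveJoint_eq_withDensity hT hv, Measure.map_apply measurable_snd hs,
    withDensity_apply _ (measurable_snd hs), withDensity_apply _ hs]
  have h1 : (Prod.snd ⁻¹' s : Set (Ω × ℝ)) = Set.univ ×ˢ s := by ext; simp
  rw [h1, ← Measure.prod_restrict, Measure.restrict_univ,
    lintegral_prod_symm _ (measurable_channelPDF hT).aemeasurable]
  rfl

variable [IsProbabilityMeasure μ]

lemma outputPDF_le (y : ℝ) : outputPDF μ T v y ≤ ENNReal.ofReal (√(2 * π * v))⁻¹ := by
  calc outputPDF μ T v y ≤ ∫⁻ _, ENNReal.ofReal (√(2 * π * v))⁻¹ ∂μ := by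
        refine lintegral_mono fun ω => ENNReal.ofReal_le_ofReal ?_
        rw [gaussianPDFReal]
        refine mul_le_of_le_one_right (by positivity) (Real.exp_le_one_iff.2 ?_)
        rw [neg_div]
        exact neg_nonpos.2 (by positivity)
    _ = _ := by simp

lemma le_outputPDF {C : ℝ} (hTC : ∀ᵐ ω ∂μ, T ω ∈ Set.Icc 0 C) (y : ℝ) :
    ENNReal.ofReal ((√(2 * π * v))⁻¹ * Real.exp (-(|y| + C) ^ 2 / (2 * v)))
      ≤ outputPDF μ T v y := by
  calc _ = ∫⁻ _, ENNReal.ofReal ((√(2 * π * v))⁻¹ * Real.exp (-(|y| + C) ^ 2 / (2 * v))) ∂μ := by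
        simp
    _ ≤ _ := by
        refine lintegral_mono_ae (hTC.mono fun ω hω => ENNReal.ofReal_le_ofReal ?_)
        rw [gaussianPDFReal]
        have : (y - T ω) ^ 2 ≤ (|y| + C) ^ 2 := by
          refine sq_le_sq' ?_ ?_
          · linarith [neg_abs_le y, hω.2]
          · linarith [le_abs_self y, hω.1, hω.2]
        gcongr

lemma outputPDF_ne_top (y : ℝ) : outputPDF μ T v y ≠ ∞ :=
  ((outputPDF_le y).trans_lt ENNReal.ofReal_lt_top).ne

lemma outputPDF_ne_zero {C : ℝ} (hv : v ≠ 0) (hTC : ∀ᵐ ω ∂μ, T ω ∈ Set.Icc 0 C) (y : ℝ) :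
    outputPDF μ T v y ≠ 0 := by
  have hv' : (0 : ℝ) < v := by exact_mod_cast pos_iff_ne_zero.2 hv
  refine (lt_of_lt_of_le ?_ (le_outputPDF hTC y)).ne'
  exact ENNReal.ofReal_pos.2 (by positivity)

lemma measurable_channelPDF_div (hT : Measurable T) : Measurable
    (fun q : Ω × ℝ => gaussianPDF (T q.1) v q.2 / outputPDF μ T v q.2) :=
  (measurable_channelPDF hT).div ((measurable_outputPDF hT).comp measurable_snd)

lemma additiveJoint_eq_prod_withDensity {C : ℝ} (hT : Measurable T) (hv : v ≠ 0)
    (hTC : ∀ᵐ ω ∂μ, T ω ∈ Set.Icc 0 C) :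
    additiveJoint μ T v = (μ.prod (volume.withDensity (outputPDF μ T v))).withDensity
      (fun q => gaussianPDF (T q.1) v q.2 / outputPDF μ T v q.2) := by
  have hF := measurable_outputPDF (μ := μ) (v := v) hT
  have hF' : Measurable (fun q : Ω × ℝ => outputPDF μ T v q.2) := hF.comp measurable_snd
  rw [prod_withDensity_right hF, ← withDensity_mul _ hF' (measurable_channelPDF_div hT),
    additiveJoint_eq_withDensity hT hv]
  congr 1
  ext q
  exact (ENNReal.mul_div_cancel (outputPDF_ne_zero hv hTC q.2) (outputPDF_ne_top q.2)).symm

lemma llr_additiveJoint {C : ℝ} (hT : Measurable T) (hv : v ≠ 0)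
    (hTC : ∀ᵐ ω ∂μ, T ω ∈ Set.Icc 0 C) :
    ∀ᵐ p ∂(μ.prod (gaussianReal 0 v)),
      llr (additiveJoint μ T v) (μ.prod (volume.withDensity (outputPDF μ T v)))
          (p.1, T p.1 + p.2)
        = Real.log (gaussianPDFReal 0 v p.2)
          - Real.log (outputPDF μ T v (T p.1 + p.2)).toReal := by
  have hsf : SigmaFinite ((volume : Measure ℝ).withDensity (outputPDF μ T v)) :=
    SigmaFinite.withDensity_of_ne_top (Eventually.of_forall outputPDF_ne_top)
  have key := Measure.rnDeriv_withDensity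
    (μ.prod ((volume : Measure ℝ).withDensity (outputPDF μ T v)))
    (measurable_channelPDF_div (μ := μ) (v := v) hT)
  have hac : additiveJoint μ T v ≪ μ.prod ((volume : Measure ℝ).withDensity (outputPDF μ T v)) := by
    rw [additiveJoint_eq_prod_withDensity hT hv hTC]
    exact withDensity_absolutelyContinuous _ _
  have key2 := hac.ae_le key
  have key3 := ae_of_ae_map (measurable_additive hT).aemeasurable key2
  filter_upwards [key3] with p hp
  rw [llr, additiveJoint_eq_prod_withDensity hT hv hTC, hp]
  have hpos := gaussianPDFReal_pos 0 v p.2 hv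
  have hF0 := ENNReal.toReal_pos (outputPDF_ne_zero hv hTC (T p.1 + p.2))
    (outputPDF_ne_top (T p.1 + p.2))
  simp only [ENNReal.toReal_div, toReal_gaussianPDF]
  have : gaussianPDFReal (T p.1) v (T p.1 + p.2) = gaussianPDFReal 0 v p.2 := by
    simp [gaussianPDFReal]
  rw [this, Real.log_div hpos.ne' hF0.ne']

lemma log_gaussianPDFReal (hv : v ≠ 0) (z : ℝ) :
    Real.log (gaussianPDFReal 0 v z) = -Real.log (√(2 * π * v)) - z ^ 2 / (2 * v) := by
  have hv' : (0 : ℝ) < v := by exact_mod_cast pos_iff_ne_zero.2 hv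
  rw [gaussianPDFReal, Real.log_mul (by positivity) (Real.exp_pos _).ne', Real.log_exp,
    Real.log_inv, sub_zero]
  ring

lemma integrable_llr_additiveJoint {C : ℝ} (hT : Measurable T) (hv : v ≠ 0)
    (hTC : ∀ᵐ ω ∂μ, T ω ∈ Set.Icc 0 C) :
    Integrable (llr (additiveJoint μ T v) (μ.prod (volume.withDensity (outputPDF μ T v))))
      (additiveJoint μ T v) := by
  have hv' : (0 : ℝ) < v := by exact_mod_cast pos_iff_ne_zero.2 hv
  rw [additiveJoint, integrable_map_measure (measurable_llr _ _).aestronglyMeasurable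
    (measurable_additive hT).aemeasurable, ← additiveJoint]
  have hsq : Integrable (fun z : ℝ => (z ^ 2 + 4 * C ^ 2) / v) (gaussianReal 0 v) :=
    ((memLp_id_gaussianReal 2).integrable_sq.add (integrable_const _)).div_const _
  have hdom : Integrable (fun p : Ω × ℝ => (p.2 ^ 2 + 4 * C ^ 2) / v)
      (μ.prod (gaussianReal 0 v)) := hsq.comp_snd μ
  refine hdom.mono' (((measurable_llr _ _).comp (measurable_additive hT)).aestronglyMeasurable) ?_
  have hTC' : ∀ᵐ p ∂(μ.prod (gaussianReal 0 v)), T p.1 ∈ Set.Icc 0 C :=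
    Measure.quasiMeasurePreserving_fst.ae hTC
  filter_upwards [llr_additiveJoint hT hv hTC, hTC'] with p hp hpC
  simp only [Function.comp]
  rw [hp, log_gaussianPDFReal hv, Real.norm_eq_abs]
  have hF0 := ENNReal.toReal_pos (outputPDF_ne_zero hv hTC (T p.1 + p.2))
    (outputPDF_ne_top (T p.1 + p.2))
  have hup : Real.log (outputPDF μ T v (T p.1 + p.2)).toReal ≤ -Real.log (√(2 * π * v)) := by
    rw [← Real.log_inv]
    exact Real.log_le_log hF0 (ENNReal.toReal_le_of_le_ofReal (by positivity) (outputPDF_le _))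
  have hlow : -Real.log (√(2 * π * v)) - (|T p.1 + p.2| + C) ^ 2 / (2 * v)
      ≤ Real.log (outputPDF μ T v (T p.1 + p.2)).toReal := by
    have h1 := (ENNReal.ofReal_le_iff_le_toReal (outputPDF_ne_top (T p.1 + p.2))).1
      (le_outputPDF (v := v) hTC (T p.1 + p.2))
    have h2 := Real.log_le_log (by positivity) h1
    rw [Real.log_mul (by positivity) (Real.exp_pos _).ne', Real.log_exp, Real.log_inv] at h2
    rw [sub_eq_add_neg, ← neg_div]
    exact h2
  have hsqle : (|T p.1 + p.2| + C) ^ 2 / (2 * v) ≤ (p.2 ^ 2 + 4 * C ^ 2) / v := by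
    rw [div_le_div_iff₀ (by positivity) hv']
    have habs : |T p.1 + p.2| ≤ C + |p.2| := by
      refine (abs_add_le _ _).trans ?_
      rw [abs_of_nonneg hpC.1]
      linarith [hpC.2]
    have hC : 0 ≤ C := hpC.1.trans hpC.2
    have h3 : (|T p.1 + p.2| + C) ^ 2 ≤ (|p.2| + 2 * C) ^ 2 := by
      apply pow_le_pow_left₀ (by positivity)
      linarith
    have h4 : (|p.2| + 2 * C) ^ 2 ≤ 2 * (p.2 ^ 2 + 4 * C ^ 2) := by
      nlinarith [sq_nonneg (|p.2| - 2 * C), sq_abs p.2]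
    nlinarith
  have hz : p.2 ^ 2 / (2 * v) ≤ (p.2 ^ 2 + 4 * C ^ 2) / v := by
    rw [div_le_div_iff₀ (by positivity) hv']
    nlinarith [sq_nonneg p.2, sq_nonneg C, mul_nonneg (sq_nonneg p.2) hv'.le,
      mul_nonneg (sq_nonneg C) hv'.le]
  have hz0 : 0 ≤ p.2 ^ 2 / (2 * v) := by positivity
  rw [abs_le]
  constructor <;> linarith

/-- The duality bound: any subprobability density `R` on the output bounds the mutual information
of an additive Gaussian channel with bounded input. -/
lemma mutualInfo_additiveJoint_le {C : ℝ} (hT : Measurable T) (hv : v ≠ 0)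
    (hTC : ∀ᵐ ω ∂μ, T ω ∈ Set.Icc 0 C) {R : ℝ → ℝ} (hR : Integrable R) (hRpos : ∀ y, 0 < R y)
    (hR1 : ∫ y, R y ≤ 1) {G : Ω × ℝ → ℝ} (hG : Integrable G (μ.prod (gaussianReal 0 v)))
    (hRG : ∀ᵐ p ∂(μ.prod (gaussianReal 0 v)),
      Real.log (gaussianPDFReal 0 v p.2) - Real.log (R (T p.1 + p.2)) ≤ G p) :
    mutualInfo (additiveJoint μ T v)
      ≤ ((∫ p, G p ∂(μ.prod (gaussianReal 0 v)) : ℝ) : EReal) := by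
  have hF := measurable_outputPDF (μ := μ) (v := v) hT
  have hac : additiveJoint μ T v ≪ μ.prod ((volume : Measure ℝ).withDensity (outputPDF μ T v)) := by
    rw [additiveJoint_eq_prod_withDensity hT hv hTC]
    exact withDensity_absolutelyContinuous _ _
  have hint := integrable_llr_additiveJoint hT hv hTC
  rw [mutualInfo, additiveJoint_map_fst hT, additiveJoint_map_snd hT hv, klDiv, if_pos ⟨hac, hint⟩]
  refine EReal.coe_le_coe_iff.2 ?_
  have hF0 : ∀ y, 0 < (outputPDF μ T v y).toReal := fun y =>
    ENNReal.toReal_pos (outputPDF_ne_zero hv hTC y) (outputPDF_ne_top y)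
  have hae : ∀ᵐ y : ℝ, outputPDF μ T v y < ∞ :=
    Eventually.of_forall fun y => (outputPDF_ne_top y).lt_top
  have hsm : ∀ y, (outputPDF μ T v y).toReal • (R y / (outputPDF μ T v y).toReal) = R y := by
    intro y
    rw [smul_eq_mul, mul_div_cancel₀ _ (hF0 y).ne']
  have hratio : Integrable (fun y => R y / (outputPDF μ T v y).toReal)
      (volume.withDensity (outputPDF μ T v)) := by
    rw [integrable_withDensity_iff_integrable_smul' hF hae]
    simpa only [hsm] using hR
  have hratio_int : ∫ y, R y / (outputPDF μ T v y).toReal ∂(volume.withDensity (outputPDF μ T v))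
      = ∫ y, R y := by
    rw [integral_withDensity_eq_integral_toReal_smul hF hae]
    simp only [hsm]
  have hlaw : (μ.prod (gaussianReal 0 v)).map (fun p => T p.1 + p.2)
      = volume.withDensity (outputPDF μ T v) := by
    rw [← additiveJoint_map_snd hT hv, additiveJoint,
      Measure.map_map measurable_snd (measurable_additive hT)]
    rfl
  have hmY : AEMeasurable (fun p : Ω × ℝ => T p.1 + p.2) (μ.prod (gaussianReal 0 v)) := by
    fun_prop
  rw [← hlaw] at hratio hratio_int
  have hratio' : Integrable (fun p : Ω × ℝ =>
      R (T p.1 + p.2) / (outputPDF μ T v (T p.1 + p.2)).toReal) (μ.prod (gaussianReal 0 v)) :=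
    hratio.comp_aemeasurable hmY
  rw [integral_map hmY hratio.aestronglyMeasurable] at hratio_int
  have hmG := (measurable_additive (Ω := Ω) hT).aemeasurable (μ := μ.prod (gaussianReal 0 v))
  have hcomp : ∫ q, llr (additiveJoint μ T v) (μ.prod (volume.withDensity (outputPDF μ T v))) q
        ∂(additiveJoint μ T v)
      = ∫ p, llr (additiveJoint μ T v) (μ.prod (volume.withDensity (outputPDF μ T v)))
        (p.1, T p.1 + p.2) ∂(μ.prod (gaussianReal 0 v)) := by
    conv_lhs => rw [additiveJoint]
    rw [integral_map hmG (measurable_llr _ _).aestronglyMeasurable]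
    rfl
  have hintg : Integrable (fun p : Ω × ℝ =>
      llr (additiveJoint μ T v) (μ.prod (volume.withDensity (outputPDF μ T v)))
        (p.1, T p.1 + p.2)) (μ.prod (gaussianReal 0 v)) :=
    (integrable_map_measure (measurable_llr _ _).aestronglyMeasurable hmG).1 hint
  rw [hcomp]
  have hdom : Integrable (fun p : Ω × ℝ =>
      (R (T p.1 + p.2) / (outputPDF μ T v (T p.1 + p.2)).toReal - 1) + G p)
      (μ.prod (gaussianReal 0 v)) := (hratio'.sub (integrable_const 1)).add hG
  have hle : ∫ p, llr (additiveJoint μ T v) (μ.prod (volume.withDensity (outputPDF μ T v)))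
        (p.1, T p.1 + p.2) ∂(μ.prod (gaussianReal 0 v))
      ≤ ∫ p, ((R (T p.1 + p.2) / (outputPDF μ T v (T p.1 + p.2)).toReal - 1) + G p)
        ∂(μ.prod (gaussianReal 0 v)) := by
    refine integral_mono_ae hintg hdom ?_
    filter_upwards [llr_additiveJoint hT hv hTC, hRG] with p hp hpG
    rw [hp]
    have h1 := Real.log_le_sub_one_of_pos (div_pos (hRpos (T p.1 + p.2)) (hF0 (T p.1 + p.2)))
    rw [Real.log_div (hRpos _).ne' (hF0 _).ne'] at h1
    linarith
  refine hle.trans ?_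
  have hsub : Integrable (fun p : Ω × ℝ =>
      R (T p.1 + p.2) / (outputPDF μ T v (T p.1 + p.2)).toReal - 1) (μ.prod (gaussianReal 0 v)) :=
    hratio'.sub (integrable_const 1)
  rw [integral_add hsub hG, integral_sub hratio' (integrable_const 1), hratio_int]
  simp only [integral_const, probReal_univ, smul_eq_mul, mul_one]
  linarith

end OutputLaw

section CentralGaussian

variable {v : ℝ≥0} {δ B : ℝ}

lemma gaussianPDFReal_zero_eq (v : ℝ≥0) (z : ℝ) :
    gaussianPDFReal 0 v z = (√(2 * π * v))⁻¹ * Real.exp (-z ^ 2 / (2 * v)) := by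
  simp [gaussianPDFReal]

lemma continuous_gaussianPDFReal_zero (v : ℝ≥0) : Continuous (gaussianPDFReal 0 v) := by
  have : gaussianPDFReal 0 v
      = fun z => (√(2 * π * v))⁻¹ * Real.exp (-z ^ 2 / (2 * v)) :=
    funext (gaussianPDFReal_zero_eq v)
  rw [this]
  fun_prop

lemma hasDerivAt_gaussianPDFReal_zero (v : ℝ≥0) (z : ℝ) :
    HasDerivAt (gaussianPDFReal 0 v) (-(z / v) * gaussianPDFReal 0 v z) z := by
  have hfun : gaussianPDFReal 0 v
      = fun z => (√(2 * π * v))⁻¹ * Real.exp (-z ^ 2 / (2 * v)) :=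
    funext (gaussianPDFReal_zero_eq v)
  have h1 : HasDerivAt (fun z : ℝ => -z ^ 2 / (2 * v)) (-(2 * z) / (2 * v)) z := by
    simpa using ((hasDerivAt_pow 2 z).neg).div_const (2 * (v : ℝ))
  have h2 := (h1.exp).const_mul (√(2 * π * v))⁻¹
  rw [hfun]
  refine h2.congr_deriv ?_
  have h3 : -(2 * z) / (2 * (v : ℝ)) = -(z / v) := by
    rw [neg_div, mul_div_mul_left _ _ two_ne_zero]
  rw [h3]
  ring

lemma gaussQ_div_sqrt (hv : v ≠ 0) (δ : ℝ) :
    gaussQ (δ / √v) = ∫ z in Set.Ioi δ, gaussianPDFReal 0 v z := by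
  have hv' : (0 : ℝ) < v := by exact_mod_cast pos_iff_ne_zero.2 hv
  have hs : (0 : ℝ) < √v := Real.sqrt_pos.2 hv'
  have hb : (0 : ℝ) < (√(v : ℝ))⁻¹ := inv_pos.2 hs
  have h := integral_comp_mul_left_Ioi'
    (fun t => 1 / √(2 * π) * Real.exp (-t ^ 2 / 2)) δ hb
  rw [gaussQ, show δ / √(v : ℝ) = (√(v : ℝ))⁻¹ * δ by ring, ← h, smul_eq_mul,
    ← integral_const_mul]
  congr 1
  ext z
  rw [gaussianPDFReal_zero_eq, Real.sqrt_mul (by positivity) (v : ℝ)]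
  have : -((√(v : ℝ))⁻¹ * z) ^ 2 / 2 = -z ^ 2 / (2 * v) := by
    rw [mul_pow, inv_pow, Real.sq_sqrt hv'.le]
    field_simp
  rw [this, mul_inv]
  ring

lemma integral_Iio_neg_gaussianPDFReal (v : ℝ≥0) (δ : ℝ) :
    ∫ z in Set.Iio (-δ), gaussianPDFReal 0 v z = ∫ z in Set.Ioi δ, gaussianPDFReal 0 v z := by
  have h := integral_comp_neg_Iic (-δ) (gaussianPDFReal 0 v)
  rw [neg_neg] at h
  rw [← h, integral_Iic_eq_integral_Iio]
  congr 1
  ext z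
  simp [gaussianPDFReal_zero_eq]

lemma intervalIntegral_gaussianPDFReal (hv : v ≠ 0) (δ : ℝ) :
    ∫ z in (-δ)..δ, gaussianPDFReal 0 v z = 1 - 2 * gaussQ (δ / √v) := by
  have hi := integrable_gaussianPDFReal 0 v
  have h1 := intervalIntegral.integral_Iic_sub_Iic (a := -δ) (b := δ)
    hi.integrableOn hi.integrableOn
  have h2 := intervalIntegral.integral_Iic_add_Ioi (b := δ) hi.integrableOn hi.integrableOn
  rw [integral_gaussianPDFReal_eq_one 0 hv] at h2
  rw [integral_Iic_eq_integral_Iio (x := -δ), integral_Iio_neg_gaussianPDFReal] at h1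
  rw [gaussQ_div_sqrt hv]
  linarith

lemma one_sub_two_gaussQ_pos (hv : v ≠ 0) (hδ : 0 < δ) : 0 < 1 - 2 * gaussQ (δ / √v) := by
  rw [← intervalIntegral_gaussianPDFReal hv]
  exact intervalIntegral.intervalIntegral_pos_of_pos
    ((continuous_gaussianPDFReal_zero v).intervalIntegrable _ _)
    (fun z => gaussianPDFReal_pos 0 v z hv) (by linarith)

lemma one_sub_two_gaussQ_le (hv : v ≠ 0) (hδ : 0 < δ) :
    1 - 2 * gaussQ (δ / √v) ≤ (√(2 * π * v))⁻¹ * (2 * δ) := by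
  rw [← intervalIntegral_gaussianPDFReal hv]
  calc ∫ z in (-δ)..δ, gaussianPDFReal 0 v z
      ≤ ∫ _ in (-δ)..δ, (√(2 * π * v))⁻¹ := by
        refine intervalIntegral.integral_mono_on (by linarith)
          ((continuous_gaussianPDFReal_zero v).intervalIntegrable _ _)
          intervalIntegrable_const fun z _ => ?_
        rw [gaussianPDFReal_zero_eq]
        refine mul_le_of_le_one_right (by positivity) (Real.exp_le_one_iff.2 ?_)
        rw [neg_div]
        exact neg_nonpos.2 (by positivity)
    _ = _ := by
        rw [intervalIntegral.integral_const, smul_eq_mul]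
        ring

lemma integral_indicator_gaussianReal (hv : v ≠ 0) {a b : ℝ} (hab : a ≤ b) (f : ℝ → ℝ) :
    ∫ z, (Set.Icc a b).indicator f z ∂(gaussianReal 0 v)
      = ∫ z in a..b, gaussianPDFReal 0 v z * f z := by
  rw [integral_gaussianReal_eq_integral_smul hv, intervalIntegral.integral_of_le hab,
    ← integral_Icc_eq_integral_Ioc, ← integral_indicator measurableSet_Icc]
  congr 1
  ext z
  by_cases hz : z ∈ Set.Icc a b <;> simp [hz]

lemma integral_indicator_sq_gaussianReal (hv : v ≠ 0) (hδ : 0 < δ) :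
    ∫ z, (Set.Icc (-δ) δ).indicator (fun z => z ^ 2 / (2 * v)) z ∂(gaussianReal 0 v)
      = (1 - 2 * gaussQ (δ / √v)) / 2 - δ * gaussianPDFReal 0 v δ := by
  have hv' : (v : ℝ) ≠ 0 := by exact_mod_cast hv
  have hc := continuous_gaussianPDFReal_zero v
  rw [integral_indicator_gaussianReal hv (by linarith), ← intervalIntegral_gaussianPDFReal hv]
  have hd : ∀ z ∈ Set.uIcc (-δ) δ, HasDerivAt (fun z => -(z * gaussianPDFReal 0 v z) / 2)
      (gaussianPDFReal 0 v z * (z ^ 2 / (2 * v)) - gaussianPDFReal 0 v z / 2) z := by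
    intro z _
    have := (((hasDerivAt_id z).mul (hasDerivAt_gaussianPDFReal_zero v z)).neg).div_const 2
    refine this.congr_deriv ?_
    simp only [id]
    field_simp
    ring
  have hi1 : IntervalIntegrable (fun z => gaussianPDFReal 0 v z * (z ^ 2 / (2 * v)))
      volume (-δ) δ := Continuous.intervalIntegrable (by fun_prop) _ _
  have hi2 : IntervalIntegrable (fun z => gaussianPDFReal 0 v z / 2) volume (-δ) δ :=
    Continuous.intervalIntegrable (by fun_prop) _ _
  have h := intervalIntegral.integral_eq_sub_of_hasDerivAt hd (hi1.sub hi2)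
  rw [intervalIntegral.integral_sub hi1 hi2, intervalIntegral.integral_div] at h
  have heven : gaussianPDFReal 0 v (-δ) = gaussianPDFReal 0 v δ := by
    simp [gaussianPDFReal_zero_eq]
  rw [heven] at h
  linarith

lemma integral_indicator_id_gaussianReal (hv : v ≠ 0) (hδ : 0 < δ) (hB : 0 < B) :
    ∫ z, (Set.Icc (-δ) (B + δ)).indicator (fun z => z) z ∂(gaussianReal 0 v)
      = v * (gaussianPDFReal 0 v δ - gaussianPDFReal 0 v (B + δ)) := by
  have hv' : (v : ℝ) ≠ 0 := by exact_mod_cast hv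
  have hc := continuous_gaussianPDFReal_zero v
  rw [integral_indicator_gaussianReal hv (by linarith)]
  have hd : ∀ z ∈ Set.uIcc (-δ) (B + δ), HasDerivAt (fun z => -(v * gaussianPDFReal 0 v z))
      (gaussianPDFReal 0 v z * z) z := by
    intro z _
    refine (((hasDerivAt_gaussianPDFReal_zero v z).const_mul (v : ℝ)).neg).congr_deriv ?_
    field_simp
  have h := intervalIntegral.integral_eq_sub_of_hasDerivAt hd
    (Continuous.intervalIntegrable (by fun_prop) _ _)
  have heven : gaussianPDFReal 0 v (-δ) = gaussianPDFReal 0 v δ := by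
    simp [gaussianPDFReal_zero_eq]
  rw [heven] at h
  rw [h]
  ring

end CentralGaussian

section TestDensity

variable {v : ℝ≥0} {δ B m : ℝ}

/-- The difference of exponentials normalising the truncated exponential density on
`[-δ, B + δ]`. -/
noncomputable def expGap (B δ m : ℝ) : ℝ :=
  Real.exp (m * δ / B) - Real.exp (-(m * (1 + δ / B)))

/-- The output density with Gaussian tails outside `[-δ, B + δ]` and a truncated exponential
on `[-δ, B + δ]`. -/
noncomputable def testPDF (v : ℝ≥0) (B δ m y : ℝ) : ℝ :=
  (Set.Iio (-δ)).indicator (gaussianPDFReal 0 v) y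
    + (Set.Ioi δ).indicator (gaussianPDFReal 0 v) (y - B)
    + (Set.Icc (-δ) (B + δ)).indicator
      (fun w => m * (1 - 2 * gaussQ (δ / √v)) / (B * expGap B δ m) * Real.exp (-(m / B * w))) y

/-- The logarithm of the ratio of the Gaussian peak density to the exponential prefactor. -/
noncomputable def logPeak (v : ℝ≥0) (B δ m : ℝ) : ℝ :=
  Real.log (B * expGap B δ m / (m * (1 - 2 * gaussQ (δ / √v)) * √(2 * π * v)))

lemma two_mul_le_expGap (hδ : 0 < δ) (hB : 0 < B) (hm : 0 < m) :
    2 * (m * δ / B) ≤ expGap B δ m := by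
  have h1 := Real.self_le_sinh_iff.2 (show 0 ≤ m * δ / B by positivity)
  rw [Real.sinh_eq] at h1
  have h2 : Real.exp (-(m * (1 + δ / B))) ≤ Real.exp (-(m * δ / B)) := by
    refine Real.exp_le_exp.2 ?_
    rw [mul_add, mul_one, mul_div_assoc]
    linarith
  rw [expGap]
  linarith

lemma expGap_pos (hδ : 0 < δ) (hB : 0 < B) (hm : 0 < m) : 0 < expGap B δ m :=
  lt_of_lt_of_le (by positivity) (two_mul_le_expGap hδ hB hm)

lemma logPeak_nonneg (hv : v ≠ 0) (hδ : 0 < δ) (hB : 0 < B) (hm : 0 < m) :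
    0 ≤ logPeak v B δ m := by
  have hv' : (0 : ℝ) < v := by exact_mod_cast pos_iff_ne_zero.2 hv
  have hs : 0 < √(2 * π * (v : ℝ)) := by positivity
  have hP := one_sub_two_gaussQ_pos hv hδ
  have hP2 := one_sub_two_gaussQ_le hv hδ
  refine Real.log_nonneg ?_
  rw [one_le_div (by positivity)]
  have h1 := two_mul_le_expGap hδ hB hm
  have h2 : (1 - 2 * gaussQ (δ / √v)) * √(2 * π * v) ≤ 2 * δ := by
    rw [inv_mul_eq_div, le_div_iff₀ hs] at hP2
    exact hP2
  calc m * (1 - 2 * gaussQ (δ / √v)) * √(2 * π * v)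
      = m * ((1 - 2 * gaussQ (δ / √v)) * √(2 * π * v)) := by ring
    _ ≤ m * (2 * δ) := by gcongr
    _ = B * (2 * (m * δ / B)) := by field_simp
    _ ≤ B * expGap B δ m := by gcongr

lemma integral_exp_expGap (hB : 0 < B) (hm : 0 < m) :
    ∫ w in (-δ)..(B + δ), Real.exp (-(m / B * w)) = B / m * expGap B δ m := by
  have hd : ∀ w ∈ Set.uIcc (-δ) (B + δ), HasDerivAt (fun w => -(B / m) * Real.exp (-(m / B * w)))
      (Real.exp (-(m / B * w))) w := by
    intro w _
    have h1 : HasDerivAt (fun w : ℝ => -(m / B * w)) (-(m / B)) w := by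
      simpa using (hasDerivAt_id w).const_mul (m / B) |>.fun_neg
    refine (h1.exp.const_mul (-(B / m))).congr_deriv ?_
    field_simp
  rw [intervalIntegral.integral_eq_sub_of_hasDerivAt hd
    (Continuous.intervalIntegrable (by fun_prop) _ _), expGap]
  have h1 : -(m / B * -δ) = m * δ / B := by ring
  have h2 : -(m / B * (B + δ)) = -(m * (1 + δ / B)) := by field_simp
  rw [h1, h2]
  ring

lemma integrable_testPDF (v : ℝ≥0) (B δ m : ℝ) : Integrable (testPDF v B δ m) := by
  have hi := integrable_gaussianPDFReal 0 v
  refine ((hi.indicator measurableSet_Iio).add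
    ((hi.indicator measurableSet_Ioi).comp_sub_right B)).add ?_
  rw [integrable_indicator_iff measurableSet_Icc]
  exact Continuous.integrableOn_Icc (by fun_prop)

lemma integral_testPDF (hv : v ≠ 0) (hδ : 0 < δ) (hB : 0 < B) (hm : 0 < m) :
    ∫ y, testPDF v B δ m y = 1 := by
  have hi := integrable_gaussianPDFReal 0 v
  have hi1 := hi.indicator (measurableSet_Iio (a := -δ))
  have hi2 := (hi.indicator (measurableSet_Ioi (a := δ))).comp_sub_right B
  have hi3 : Integrable ((Set.Icc (-δ) (B + δ)).indicator
      (fun w => m * (1 - 2 * gaussQ (δ / √v)) / (B * expGap B δ m) * Real.exp (-(m / B * w)))) := by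
    rw [integrable_indicator_iff measurableSet_Icc]
    exact Continuous.integrableOn_Icc (by fun_prop)
  have hE := expGap_pos hδ hB hm
  have hi12 : Integrable (fun y => (Set.Iio (-δ)).indicator (gaussianPDFReal 0 v) y
    + (Set.Ioi δ).indicator (gaussianPDFReal 0 v) (y - B)) := hi1.add hi2
  simp only [testPDF]
  rw [integral_add hi12 hi3, integral_add hi1 hi2,
    integral_sub_right_eq_self (fun y => (Set.Ioi δ).indicator (gaussianPDFReal 0 v) y),
    integral_indicator measurableSet_Iio, integral_indicator measurableSet_Ioi,
    integral_indicator measurableSet_Icc, integral_Icc_eq_integral_Ioc,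
    ← intervalIntegral.integral_of_le (by linarith), intervalIntegral.integral_const_mul,
    integral_exp_expGap hB hm, integral_Iio_neg_gaussianPDFReal, ← gaussQ_div_sqrt hv]
  field_simp
  ring

lemma testPDF_of_lt (hB : 0 < B) (hδ : 0 < δ) {y : ℝ} (hy : y < -δ) :
    testPDF v B δ m y = gaussianPDFReal 0 v y := by
  have h2 : y - B ∉ Set.Ioi δ := by simp only [Set.mem_Ioi]; linarith
  have h3 : y ∉ Set.Icc (-δ) (B + δ) := fun h => absurd h.1 (by linarith)
  simp [testPDF, Set.indicator_of_mem (Set.mem_Iio.2 hy), h2, Set.indicator_of_notMem h3]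

lemma testPDF_of_gt (hB : 0 < B) (hδ : 0 < δ) {y : ℝ} (hy : B + δ < y) :
    testPDF v B δ m y = gaussianPDFReal 0 v (y - B) := by
  have h1 : y ∉ Set.Iio (-δ) := by simp only [Set.mem_Iio]; linarith
  have h2 : y - B ∈ Set.Ioi δ := by simp only [Set.mem_Ioi]; linarith
  have h3 : y ∉ Set.Icc (-δ) (B + δ) := fun h => absurd h.2 (by linarith)
  rw [testPDF, Set.indicator_of_notMem h1, Set.indicator_of_mem h2, Set.indicator_of_notMem h3]
  ring

lemma testPDF_of_mem {y : ℝ} (hy : y ∈ Set.Icc (-δ) (B + δ)) :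
    testPDF v B δ m y
      = m * (1 - 2 * gaussQ (δ / √v)) / (B * expGap B δ m) * Real.exp (-(m / B * y)) := by
  have h1 : y ∉ Set.Iio (-δ) := fun h => absurd hy.1 (not_le.2 h)
  have h2 : y - B ∉ Set.Ioi δ := fun h => absurd hy.2 (by simp only [Set.mem_Ioi] at h; linarith)
  rw [testPDF, Set.indicator_of_notMem h1, Set.indicator_of_notMem h2, Set.indicator_of_mem hy]
  ring

lemma testPDF_pos (hv : v ≠ 0) (hδ : 0 < δ) (hB : 0 < B) (hm : 0 < m) (y : ℝ) :
    0 < testPDF v B δ m y := by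
  have hE := expGap_pos hδ hB hm
  have hP := one_sub_two_gaussQ_pos hv hδ
  rcases lt_or_ge y (-δ) with h | h
  · rw [testPDF_of_lt hB hδ h]
    exact gaussianPDFReal_pos 0 v y hv
  · rcases lt_or_ge (B + δ) y with h' | h'
    · rw [testPDF_of_gt hB hδ h']
      exact gaussianPDFReal_pos 0 v _ hv
    · rw [testPDF_of_mem ⟨h, h'⟩]
      positivity

/-- Pointwise control of the log-likelihood ratio between the channel law and the test density by
a function in which input and noise separate. -/
lemma log_gaussianPDFReal_sub_log_testPDF_le (hv : v ≠ 0) (hδ : 0 < δ) (hB : 0 < B) (hm : 0 < m)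
    {t : ℝ} (ht : t ∈ Set.Icc 0 B) (z : ℝ) :
    Real.log (gaussianPDFReal 0 v z) - Real.log (testPDF v B δ m (t + z))
      ≤ logPeak v B δ m + m / B * t
        - (Set.Icc (-δ) δ).indicator (fun z => z ^ 2 / (2 * v)) z
        + m / B * (Set.Icc (-δ) (B + δ)).indicator (fun z => z) z := by
  have hv' : (0 : ℝ) < v := by exact_mod_cast pos_iff_ne_zero.2 hv
  obtain ⟨ht0, htB⟩ := ht
  have hL := logPeak_nonneg hv hδ hB hm
  have hmB : 0 < m / B := by positivity
  have hmt : 0 ≤ m / B * t := by positivity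
  rcases lt_or_ge (t + z) (-δ) with h | h
  · have h1 : z ∉ Set.Icc (-δ) δ := fun hz => absurd hz.1 (by linarith)
    have h2 : z ∉ Set.Icc (-δ) (B + δ) := fun hz => absurd hz.1 (by linarith)
    rw [testPDF_of_lt hB hδ h, Set.indicator_of_notMem h1, Set.indicator_of_notMem h2,
      log_gaussianPDFReal hv, log_gaussianPDFReal hv]
    have : (t + z) ^ 2 / (2 * v) ≤ z ^ 2 / (2 * v) := by
      gcongr ?_ / _
      nlinarith
    linarith
  · rcases lt_or_ge (B + δ) (t + z) with h' | h'
    · have h1 : z ∉ Set.Icc (-δ) δ := fun hz => absurd hz.2 (by linarith)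
      have h2 : 0 ≤ (Set.Icc (-δ) (B + δ)).indicator (fun z => z) z :=
        Set.indicator_apply_nonneg fun _ => by linarith
      rw [testPDF_of_gt hB hδ h', Set.indicator_of_notMem h1,
        log_gaussianPDFReal hv, log_gaussianPDFReal hv]
      have : (t + z - B) ^ 2 / (2 * v) ≤ z ^ 2 / (2 * v) := by
        gcongr ?_ / _
        nlinarith
      have h3 : 0 ≤ m / B * (Set.Icc (-δ) (B + δ)).indicator (fun z => z) z := by positivity
      linarith
    · have hP := one_sub_two_gaussQ_pos hv hδ
      have hE := expGap_pos hδ hB hm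
      have hs : 0 < √(2 * π * (v : ℝ)) := by positivity
      have hlog : Real.log (testPDF v B δ m (t + z))
          = -logPeak v B δ m - Real.log √(2 * π * v) - m / B * (t + z) := by
        rw [testPDF_of_mem ⟨h, h'⟩, Real.log_mul (by positivity) (Real.exp_pos _).ne',
          Real.log_exp, logPeak, Real.log_div (by positivity) (by positivity),
          Real.log_div (by positivity) (by positivity), Real.log_mul (by positivity) hs.ne']
        ring
      have h1 : (Set.Icc (-δ) δ).indicator (fun z => z ^ 2 / (2 * (v : ℝ))) z
          ≤ z ^ 2 / (2 * v) := Set.indicator_apply_le' (fun _ => le_rfl) fun _ => by positivity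
      have h2 : z ≤ (Set.Icc (-δ) (B + δ)).indicator (fun z => z) z := by
        by_cases hz : z ∈ Set.Icc (-δ) (B + δ)
        · rw [Set.indicator_of_mem hz]
        · rw [Set.indicator_of_notMem hz]
          by_contra hcon
          exact hz ⟨by linarith, by linarith⟩
      have h3 := mul_le_mul_of_nonneg_left h2 hmB.le
      rw [hlog, log_gaussianPDFReal hv]
      linarith

end TestDensity

section Assembly

lemma exists_measurable_index (a : ℕ → ℝ) (n : ℕ) :
    ∃ u : ℝ → ℕ, Measurable u ∧ (∀ t, u t ≤ n) ∧
      ∀ t ∈ Set.Icc (a 0) (a (n + 1)), t ∈ Set.Icc (a (u t)) (a (u t + 1)) := by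
  induction n with
  | zero => exact ⟨fun _ => 0, measurable_const, fun _ => le_rfl, fun t ht => ht⟩
  | succ n ih =>
    obtain ⟨u, hu, hun, hut⟩ := ih
    refine ⟨fun t => if t ≤ a (n + 1) then u t else n + 1,
      Measurable.ite measurableSet_Iic hu measurable_const, fun t => ?_, fun t ht => ?_⟩
    · dsimp only
      split_ifs
      · exact (hun t).trans (Nat.le_succ n)
      · exact le_rfl
    · by_cases h : t ≤ a (n + 1)
      · simp only [h, if_true]
        exact hut t ⟨ht.1, h⟩
      · simp only [h, if_false]
        exact ⟨(not_le.1 h).le, ht.2⟩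

variable {n : ℕ} {h : Fin n → ℝ}

lemma sCum_zero (h : Fin n → ℝ) : sCum h 0 = 0 := by simp [sCum]

lemma sCum_self (h : Fin n → ℝ) : sCum h n = ∑ k, h k := by simp [sCum]

lemma sCum_succ (h : Fin n → ℝ) (k : Fin n) : sCum h (k.val + 1) = sCum h k.val + h k := by
  have : h k = ∑ i : Fin n, if i = k then h i else 0 := by simp
  rw [sCum, sCum, this, ← Finset.sum_add_distrib]
  refine Finset.sum_congr rfl fun i _ => ?_
  have hik : i = k ↔ i.val = k.val := Fin.ext_iff
  rcases lt_trichotomy i.val k.val with h1 | h1 | h1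
  · simp [hik, h1, h1.ne, Nat.lt_succ_of_lt h1]
  · simp [hik, h1]
  · have h2 : ¬ i.val < k.val + 1 := by omega
    simp only [hik, h1.ne', h1.not_gt, h2, if_false, add_zero]

lemma exists_measurable_interval_index (hn : 0 < n) {A : ℝ} (h : Fin n → ℝ) :
    ∃ u : ℝ → Fin n, Measurable u ∧ ∀ t ∈ Set.Icc 0 (A * sCum h n),
      t - A * sCum h (u t).val ∈ Set.Icc 0 (A * h (u t)) := by
  obtain ⟨n, rfl⟩ := Nat.exists_eq_succ_of_ne_zero hn.ne'
  obtain ⟨u, hu, hun, hut⟩ := exists_measurable_index (fun j => A * sCum h j) n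
  refine ⟨fun t => ⟨u t, Nat.lt_succ_of_le (hun t)⟩, ?_, fun t ht => ?_⟩
  · have : (fun t => (⟨u t, Nat.lt_succ_of_le (hun t)⟩ : Fin (n + 1)))
        = (fun j => Fin.ofNat (n + 1) j) ∘ u := by
      ext t
      simp [Nat.mod_eq_of_lt (Nat.lt_succ_of_le (hun t))]
    rw [this]
    exact measurable_from_top.comp hu
  · have h1 := hut t (by simpa [sCum_zero] using ht)
    have h2 := sCum_succ h ⟨u t, Nat.lt_succ_of_le (hun t)⟩
    simp only at h1 h2
    rw [h2] at h1
    constructor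
    · exact sub_nonneg.2 h1.1
    · linarith [h1.2]

/-- The power needed to produce a given weighted sum under the peak constraint. -/
lemma div_add_le_sum (hord : ∀ i j : Fin n, i ≤ j → h j ≤ h i) (hpos : ∀ k, 0 < h k)
    {A : ℝ} {x : Fin n → ℝ} (hx : ∀ k, x k ∈ Set.Icc 0 A) (k : Fin n) :
    (∑ i, h i * x i - A * sCum h k.val) / h k + k.val * A ≤ ∑ i, x i := by
  have hcard : (k.val : ℝ) = ∑ i : Fin n, if i.val < k.val then (1 : ℝ) else 0 := by
    rw [Finset.sum_boole]
    have : (Finset.univ.filter fun i : Fin n => i.val < k.val) = Finset.Iio k := by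
      ext i
      simp
    rw [this, Fin.card_Iio]
  have hk := hpos k
  have hterm : ∑ i, h i * x i - A * sCum h k.val + k.val * A * h k ≤ (∑ i, x i) * h k := by
    rw [hcard, sCum, Finset.mul_sum, Finset.sum_mul, Finset.sum_mul, Finset.sum_mul,
      ← Finset.sum_sub_distrib, ← Finset.sum_add_distrib]
    refine Finset.sum_le_sum fun i _ => ?_
    obtain ⟨h0, h1⟩ := hx i
    split_ifs with hik
    · have := hord i k (Fin.le_def.2 hik.le)
      nlinarith
    · have := hord k i (Fin.le_def.2 (not_lt.1 hik))
      nlinarith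
  have heq : (∑ i, h i * x i - A * sCum h k.val) / h k + k.val * A
      = (∑ i, h i * x i - A * sCum h k.val + k.val * A * h k) / h k := by
    field_simp
  rw [heq, div_le_iff₀ hk]
  exact hterm

lemma dualityUB_eq (hpos : ∀ k, 0 < h k) {v : ℝ≥0} (hv : v ≠ 0) {A α δ m : ℝ} (hA : 0 < A)
    (hδ : 0 < δ) (hm : 0 < m) {p : Fin n → ℝ} (hp : ∀ k, 0 ≤ p k) (hp1 : ∑ k, p k = 1) :
    dualityUB h v A α p δ m = ∑ k, p k * (-Real.log (p k) + logPeak v (A * h k) δ m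
        - ((1 - 2 * gaussQ (δ / √v)) / 2 - δ * gaussianPDFReal 0 v δ)
        + m / (A * h k) *
          (v * (gaussianPDFReal 0 v δ - gaussianPDFReal 0 v (A * h k + δ))))
      + m * (α - ∑ k : Fin n, p k * (k.val : ℝ)) := by
  have hv' : (0 : ℝ) < v := by exact_mod_cast pos_iff_ne_zero.2 hv
  have hsv : 0 < √(v : ℝ) := Real.sqrt_pos.2 hv'
  have hs2 : 0 < √(2 * π) := by positivity
  have hP := one_sub_two_gaussQ_pos hv hδ
  have hne : (Finset.univ : Finset (Fin n)).Nonempty := by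
    rw [Finset.nonempty_iff_ne_empty]
    intro h0
    simp [h0] at hp1
  have hs : 0 < sCum h n := by
    rw [sCum_self]
    exact Finset.sum_pos (fun k _ => hpos k) hne
  set S := sCum h n with hS
  set c := 1 / 2 * Real.log (A ^ 2 * S ^ 2 / (2 * π * Real.exp 1 * (v : ℝ)))
    - Real.log m - Real.log (1 - 2 * gaussQ (δ / √v)) + gaussQ (δ / √v)
    + δ / (√(2 * π) * √v) * Real.exp (-δ ^ 2 / (2 * (v : ℝ))) with hc
  have hlog : 1 / 2 * Real.log (A ^ 2 * S ^ 2 / (2 * π * Real.exp 1 * (v : ℝ)))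
      = Real.log A + Real.log S - Real.log √(2 * π * v) - 1 / 2 := by
    rw [show 2 * π * Real.exp 1 * (v : ℝ) = (2 * π * v) * Real.exp 1 by ring,
      Real.log_div (by positivity) (by positivity), Real.log_mul (by positivity) (by positivity),
      Real.log_mul (by positivity) (by positivity), Real.log_exp, Real.log_pow, Real.log_pow,
      Real.log_sqrt (by positivity)]
    push_cast
    ring
  rw [dualityUB]
  congr 1
  rw [← hS, ← hc]
  have hcsum : c = ∑ k, p k * c := by rw [← Finset.sum_mul, hp1, one_mul]
  rw [hcsum, Finset.mul_sum, ← Finset.sum_sub_distrib, ← Finset.sum_add_distrib,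
    ← Finset.sum_add_distrib]
  refine Finset.sum_congr rfl fun k _ => ?_
  rcases (hp k).eq_or_lt with h0 | h0
  · simp [← h0]
  have hk := hpos k
  have hB : 0 < A * h k := by positivity
  have hE := expGap_pos hδ hB hm
  have hgap : Real.log (Real.exp (m * δ / (A * h k)) - Real.exp (-(m * (1 + δ / (A * h k)))))
      = Real.log (expGap (A * h k) δ m) := rfl
  have hpk : Real.log (p k * S / h k) = Real.log (p k) + Real.log S - Real.log (h k) := by
    rw [Real.log_div (by positivity) hk.ne', Real.log_mul h0.ne' hs.ne']
  have hL : logPeak v (A * h k) δ m = Real.log A + Real.log (h k)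
      + Real.log (expGap (A * h k) δ m) - Real.log m - Real.log (1 - 2 * gaussQ (δ / √v))
      - Real.log √(2 * π * v) := by
    rw [logPeak, Real.log_div (by positivity) (by positivity),
      Real.log_mul (by positivity) (by positivity), Real.log_mul hA.ne' hk.ne',
      Real.log_mul (by positivity) (by positivity), Real.log_mul (by positivity) (by positivity)]
    ring
  have hroot : (√(2 * π * (v : ℝ)))⁻¹ = 1 / (√(2 * π) * √v) := by
    rw [Real.sqrt_mul (by positivity) (v : ℝ), one_div]
  rw [hgap, hpk, hL, hc, hlog, gaussianPDFReal_zero_eq, gaussianPDFReal_zero_eq, hroot]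
  have hvv : (v : ℝ) * (1 / (√(2 * π) * √v)) = √v / √(2 * π) := by
    have := Real.mul_self_sqrt hv'.le
    field_simp
    nlinarith
  have hlast : m / (A * h k) * (v * (1 / (√(2 * π) * √v) * Real.exp (-δ ^ 2 / (2 * v))
        - 1 / (√(2 * π) * √v) * Real.exp (-(A * h k + δ) ^ 2 / (2 * v))))
      = m * √v / (A * √(2 * π)) * (1 / h k * (Real.exp (-δ ^ 2 / (2 * v))
        - Real.exp (-(A * h k + δ) ^ 2 / (2 * v)))) := by
    rw [← mul_sub, ← mul_assoc (v : ℝ), hvv]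
    field_simp
  rw [hlast]
  ring

end Assembly

section FeasibleInput

variable {n : ℕ} {h : Fin n → ℝ} {v : ℝ≥0} {A α δ m : ℝ}

/-- The noise-dependent part of the bound on the log-likelihood ratio. -/
noncomputable def noiseTerm (v : ℝ≥0) (B δ m z : ℝ) : ℝ :=
  -(Set.Icc (-δ) δ).indicator (fun z => z ^ 2 / (2 * (v : ℝ))) z
    + m / B * (Set.Icc (-δ) (B + δ)).indicator (fun z => z) z

lemma integrable_indicator_Icc_gaussianReal {f : ℝ → ℝ} (hf : Continuous f) (a b : ℝ) :
    Integrable ((Set.Icc a b).indicator f) (gaussianReal 0 v) :=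
  (integrable_indicator_iff measurableSet_Icc).2 hf.integrableOn_Icc

lemma integrable_noiseTerm (v : ℝ≥0) (B δ m : ℝ) :
    Integrable (noiseTerm v B δ m) (gaussianReal 0 v) :=
  (integrable_indicator_Icc_gaussianReal (by fun_prop) _ _).neg.add
    ((integrable_indicator_Icc_gaussianReal continuous_id _ _).const_mul _)

lemma integral_noiseTerm (hv : v ≠ 0) {B : ℝ} (hδ : 0 < δ) (hB : 0 < B) :
    ∫ z, noiseTerm v B δ m z ∂(gaussianReal 0 v)
      = -((1 - 2 * gaussQ (δ / √v)) / 2 - δ * gaussianPDFReal 0 v δ)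
        + m / B * (v * (gaussianPDFReal 0 v δ - gaussianPDFReal 0 v (B + δ))) := by
  have h1 : Integrable ((Set.Icc (-δ) δ).indicator (fun z => z ^ 2 / (2 * (v : ℝ))))
      (gaussianReal 0 v) := integrable_indicator_Icc_gaussianReal (by fun_prop) _ _
  have h2 : Integrable ((Set.Icc (-δ) (B + δ)).indicator (fun z : ℝ => z)) (gaussianReal 0 v) :=
    integrable_indicator_Icc_gaussianReal continuous_id _ _
  simp only [noiseTerm]
  rw [integral_add h1.fun_neg (h2.const_mul _), integral_neg, integral_const_mul,
    integral_indicator_sq_gaussianReal hv hδ, integral_indicator_id_gaussianReal hv hδ hB]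

/-- Integration against the law of a finite-valued index and an independent variable. -/
lemma integral_index_prod {Ω Ω' : Type*} [MeasurableSpace Ω] [MeasurableSpace Ω']
    {μ : Measure Ω} {ν : Measure Ω'} [IsProbabilityMeasure μ] [IsProbabilityMeasure ν]
    {U : Ω → Fin n} (hU : Measurable U) {F : Fin n → Ω' → ℝ} (hF : ∀ k, Integrable (F k) ν) :
    Integrable (fun q : Ω × Ω' => F (U q.1) q.2) (μ.prod ν) ∧
      ∫ q, F (U q.1) q.2 ∂(μ.prod ν) = ∑ k, (μ.map U).real {k} * ∫ z, F k z ∂ν := by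
  have hmeas : ∀ k, MeasurableSet (U ⁻¹' {k}) := fun k => hU (measurableSet_singleton k)
  have hsum : (fun q : Ω × Ω' => F (U q.1) q.2)
      = fun q => ∑ k, (U ⁻¹' {k}).indicator (fun _ => (1 : ℝ)) q.1 * F k q.2 := by
    ext q
    rw [Finset.sum_eq_single (U q.1)]
    · simp
    · intro k _ hk
      simp [hk.symm]
    · simp
  have hind : ∀ k, Integrable ((U ⁻¹' {k}).indicator (fun _ => (1 : ℝ))) μ := fun k =>
    (integrable_const 1).indicator (hmeas k)
  have hint : ∀ k, Integrable
      (fun q : Ω × Ω' => (U ⁻¹' {k}).indicator (fun _ => (1 : ℝ)) q.1 * F k q.2) (μ.prod ν) :=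
    fun k => (hind k).mul_prod (hF k)
  refine ⟨?_, ?_⟩
  · rw [hsum]
    exact integrable_finsetSum _ fun k _ => hint k
  · rw [hsum, integral_finsetSum _ fun k _ => hint k]
    refine Finset.sum_congr rfl fun k _ => ?_
    rw [integral_prod_mul, integral_indicator_const _ (hmeas k),
      map_measureReal_apply hU (measurableSet_singleton k)]
    simp

lemma ae_map_singleton_pos {Ω : Type*} [MeasurableSpace Ω] {μ : Measure Ω}
    [IsProbabilityMeasure μ] {U : Ω → Fin n} (hU : Measurable U) :
    ∀ᵐ ω ∂μ, 0 < (μ.map U).real {U ω} := by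
  have : IsProbabilityMeasure (μ.map U) := Measure.isProbabilityMeasure_map hU.aemeasurable
  have hk : ∀ k, ∀ᵐ ω ∂μ, (μ.map U).real {k} = 0 → U ω ≠ k := by
    intro k
    by_cases h0 : (μ.map U).real {k} = 0
    · rw [map_measureReal_apply hU (measurableSet_singleton k), measureReal_eq_zero_iff] at h0
      filter_upwards [measure_eq_zero_iff_ae_notMem.1 h0] with ω hω _
      exact hω
    · exact Eventually.of_forall fun ω h => absurd h h0
  filter_upwards [ae_all_iff.2 hk] with ω hω
  exact lt_of_le_of_ne measureReal_nonneg fun h0 => hω (U ω) h0.symm rfl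

lemma weightedSum_mem_Icc (hpos : ∀ k, 0 < h k) {x : Fin n → ℝ}
    (hx : ∀ k, x k ∈ Set.Icc 0 A) : ∑ k, h k * x k ∈ Set.Icc 0 (A * sCum h n) := by
  refine ⟨Finset.sum_nonneg fun k _ => mul_nonneg (hpos k).le (hx k).1, ?_⟩
  rw [sCum_self, Finset.mul_sum]
  refine Finset.sum_le_sum fun k _ => ?_
  rw [mul_comm A]
  exact mul_le_mul_of_nonneg_left (hx k).2 (hpos k).le

/-- Any admissible input law has mutual information bounded by the duality expression at the
probability vector of the interval index of its weighted sum. -/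
lemma exists_mutualInfo_le_dualityUB (hn : 0 < n) (hord : ∀ i j : Fin n, i ≤ j → h j ≤ h i)
    (hpos : ∀ k, 0 < h k) (hv : v ≠ 0) (hA : 0 < A) {μ : Measure (Fin n → ℝ)}
    [IsProbabilityMeasure μ] (hpeak : ∀ k, ∀ᵐ x ∂μ, x k ∈ Set.Icc 0 A)
    (havg : (∑ k, ∫ x, x k ∂μ) ≤ α * A) :
    ∃ p : Fin n → ℝ, (∀ k, 0 ≤ p k) ∧ (∑ k, p k) = 1 ∧ (∑ k : Fin n, p k * (k.val : ℝ)) ≤ α ∧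
      ∀ δ > 0, ∀ m > 0, mutualInfo (misoJoint h v μ) ≤ ((dualityUB h v A α p δ m : ℝ) : EReal) := by
  obtain ⟨u, hu, hut⟩ := exists_measurable_interval_index (A := A) hn h
  set T : (Fin n → ℝ) → ℝ := fun x => ∑ k, h k * x k with hTdef
  have hT : Measurable T := by fun_prop
  set U : (Fin n → ℝ) → Fin n := u ∘ T with hUdef
  have hU : Measurable U := hu.comp hT
  have hpr : IsProbabilityMeasure (μ.map U) := Measure.isProbabilityMeasure_map hU.aemeasurable
  set p : Fin n → ℝ := fun k => (μ.map U).real {k} with hp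
  have hp0 : ∀ k, 0 ≤ p k := fun k => measureReal_nonneg
  have hp1 : ∑ k, p k = 1 := by
    have := sum_measureReal_singleton (μ := μ.map U) (Finset.univ : Finset (Fin n))
    rw [Finset.coe_univ, probReal_univ] at this
    exact this
  have hbox : ∀ᵐ x ∂μ, ∀ k, x k ∈ Set.Icc 0 A := ae_all_iff.2 hpeak
  have hTC : ∀ᵐ x ∂μ, T x ∈ Set.Icc 0 (A * sCum h n) :=
    hbox.mono fun x hx => weightedSum_mem_Icc hpos hx
  have hcoord : ∀ k, Integrable (fun x : Fin n → ℝ => x k) μ := fun k =>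
    Integrable.of_bound (measurable_pi_apply k).aestronglyMeasurable A
      ((hpeak k).mono fun x hx => by rw [Real.norm_eq_abs, abs_of_nonneg hx.1]; exact hx.2)
  have hsumint : Integrable (fun x : Fin n → ℝ => ∑ k, x k) μ :=
    integrable_finsetSum _ fun k _ => hcoord k
  have hsumeq : ∫ x, ∑ k, x k ∂μ = ∑ k, ∫ x, x k ∂μ := integral_finsetSum _ fun k _ => hcoord k
  obtain ⟨hidx, hidxeq⟩ := integral_index_prod (μ := μ) (ν := gaussianReal 0 v) hU
    (F := fun k _ => (k.val : ℝ)) (fun k => integrable_const _)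
  have hidxμ : Integrable (fun x => ((U x).val : ℝ)) μ :=
    Integrable.of_bound ((measurable_of_finite fun k : Fin n => (k.val : ℝ)).comp
      hU).aestronglyMeasurable n (Eventually.of_forall fun x => by
        rw [Real.norm_eq_abs, abs_of_nonneg (Nat.cast_nonneg _)]
        exact_mod_cast (U x).isLt.le)
  have hidxμeq : ∫ x, ((U x).val : ℝ) ∂μ = ∑ k : Fin n, p k * (k.val : ℝ) := by
    rw [integral_fun_fst (fun x => ((U x).val : ℝ))] at hidxeq
    simpa using hidxeq
  refine ⟨p, hp0, hp1, ?_, fun δ hδ m hm => ?_⟩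
  · have hle : ∫ x, ((U x).val : ℝ) * A ∂μ ≤ ∫ x, ∑ k, x k ∂μ := by
      refine integral_mono_ae (hidxμ.mul_const A) hsumint ?_
      filter_upwards [hbox] with x hx
      have h1 := div_add_le_sum hord hpos hx (U x)
      have h2 := (hut (T x) (weightedSum_mem_Icc hpos hx)).1
      have h3 := div_nonneg h2 (hpos (u (T x))).le
      simp only [hUdef, Function.comp, hTdef] at h1 h3 ⊢
      linarith
    rw [integral_mul_const, hidxμeq, hsumeq] at hle
    exact le_of_mul_le_mul_right (hle.trans havg) hA
  have hB : ∀ k, 0 < A * h k := fun k => mul_pos hA (hpos k)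
  set R : ℝ → ℝ := fun y => ∑ k, p k * testPDF v (A * h k) δ m (y - A * sCum h k.val) with hR
  have hRk : ∀ k : Fin n, Integrable
      (fun y => p k * testPDF v (A * h k) δ m (y - A * sCum h k.val)) := fun k =>
    ((integrable_testPDF v (A * h k) δ m).comp_sub_right _).const_mul _
  have hRint : Integrable R := integrable_finsetSum _ fun k _ => hRk k
  have hR1 : ∫ y, R y ≤ 1 := by
    rw [hR, integral_finsetSum _ fun k _ => hRk k, ← hp1]
    refine Finset.sum_le_sum fun k _ => ?_
    rw [integral_const_mul, integral_sub_right_eq_self (testPDF v (A * h k) δ m),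
      integral_testPDF hv hδ (hB k) hm, mul_one]
  have hRnn : ∀ (k : Fin n) (y : ℝ),
      0 ≤ p k * testPDF v (A * h k) δ m (y - A * sCum h k.val) := fun k y =>
    mul_nonneg (hp0 k) (testPDF_pos hv hδ (hB k) hm _).le
  have hRge : ∀ (k : Fin n) (y : ℝ),
      p k * testPDF v (A * h k) δ m (y - A * sCum h k.val) ≤ R y := fun k y =>
    Finset.single_le_sum (f := fun k : Fin n =>
      p k * testPDF v (A * h k) δ m (y - A * sCum h k.val)) (fun i _ => hRnn i y)
      (Finset.mem_univ k)
  have hRpos : ∀ y, 0 < R y := by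
    intro y
    obtain ⟨k, -, hk⟩ := Finset.exists_lt_of_sum_lt (s := Finset.univ) (f := fun _ : Fin n => (0 : ℝ))
      (g := p) (by rw [hp1]; simp)
    exact lt_of_lt_of_le (mul_pos hk (testPDF_pos hv hδ (hB k) hm _)) (hRge k y)
  set F : Fin n → ℝ → ℝ := fun k z =>
    (-Real.log (p k) + logPeak v (A * h k) δ m) + noiseTerm v (A * h k) δ m z with hF
  have hFint : ∀ k, Integrable (F k) (gaussianReal 0 v) := fun k =>
    (integrable_const _).add (integrable_noiseTerm v (A * h k) δ m)
  obtain ⟨hFU, hFUeq⟩ := integral_index_prod (μ := μ) hU hFint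
  set W : (Fin n → ℝ) → ℝ := fun x => m / A * (∑ k, x k - (U x).val * A) with hW
  have hWint : Integrable W μ := (hsumint.sub (hidxμ.mul_const A)).const_mul _
  have hWint' : Integrable (fun q : (Fin n → ℝ) × ℝ => W q.1) (μ.prod (gaussianReal 0 v)) :=
    hWint.comp_fst _
  have hWle : ∫ x, W x ∂μ ≤ m * (α - ∑ k : Fin n, p k * (k.val : ℝ)) := by
    rw [hW, integral_const_mul, integral_sub hsumint (hidxμ.mul_const A), integral_mul_const,
      hidxμeq, hsumeq]
    calc _ ≤ m / A * (α * A - (∑ k : Fin n, p k * (k.val : ℝ)) * A) := by gcongr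
      _ = _ := by field_simp
  have hmain := mutualInfo_additiveJoint_le hT hv hTC hRint hRpos hR1
    (G := fun q => F (U q.1) q.2 + W q.1) (hFU.add hWint') ?_
  · refine hmain.trans (EReal.coe_le_coe_iff.2 ?_)
    rw [integral_add hFU hWint', hFUeq, integral_fun_fst W, dualityUB_eq hpos hv hA hδ hm hp0 hp1]
    simp only [probReal_univ, one_smul]
    refine add_le_add (Finset.sum_le_sum fun k _ => le_of_eq ?_) hWle
    rw [hF]
    simp only
    rw [integral_add (integrable_const _) (integrable_noiseTerm v (A * h k) δ m),
      integral_noiseTerm hv hδ (hB k)]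
    simp only [integral_const, probReal_univ, one_smul]
    rw [hp]
    ring
  · have hbox' : ∀ᵐ q ∂(μ.prod (gaussianReal 0 v)), ∀ k, q.1 k ∈ Set.Icc 0 A :=
      Measure.quasiMeasurePreserving_fst.ae hbox
    have hpU : ∀ᵐ q ∂(μ.prod (gaussianReal 0 v)), 0 < p (U q.1) :=
      Measure.quasiMeasurePreserving_fst.ae (ae_map_singleton_pos hU)
    filter_upwards [hbox', hpU] with q hx hpq
    obtain ⟨x, z⟩ := q
    simp only at hx hpq ⊢
    have ht := hut (T x) (weightedSum_mem_Icc hpos hx)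
    have hpow := div_add_le_sum hord hpos hx (U x)
    have hUx : u (T x) = U x := rfl
    rw [hUx] at ht
    set k := U x with hk
    have hpt := log_gaussianPDFReal_sub_log_testPDF_le hv hδ (hB k) hm ht z
    have htp := testPDF_pos hv hδ (hB k) hm (T x - A * sCum h k.val + z)
    have hlog := Real.log_le_log (mul_pos hpq (testPDF_pos hv hδ (hB k) hm _))
      (hRge k (T x + z))
    rw [show T x + z - A * sCum h k.val = T x - A * sCum h k.val + z by ring,
      Real.log_mul hpq.ne' htp.ne'] at hlog
    have hmt : m / (A * h k) * (T x - A * sCum h k.val) ≤ W x := by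
      have h1 : (T x - A * sCum h k.val) / h k ≤ ∑ i, x i - k.val * A := by
        simp only [hTdef]
        linarith
      calc m / (A * h k) * (T x - A * sCum h k.val)
          = m / A * ((T x - A * sCum h k.val) / h k) := by
            have := (hpos k).ne'
            field_simp
        _ ≤ _ := by
            simp only [hW]
            gcongr
    simp only [hF, noiseTerm]
    linarith

end FeasibleInput

theorem miso_capacity_upper_bound_duality (n : ℕ) (hn : 2 ≤ n) (h : Fin n → ℝ)
    (hord : ∀ i j : Fin n, i ≤ j → h j ≤ h i) (hpos : ∀ k, 0 < h k)
    (v : ℝ≥0) (hv : 0 < v)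
    (A α : ℝ) (hA : 0 < A) (hα0 : 0 < α) (hαn : α < (n : ℝ) / 2)
    (hαth : α < alphaTh h) :
    misoCapacity h v A (α * A)
      ≤ ⨆ p ∈ {p : Fin n → ℝ | (∀ k, 0 ≤ p k) ∧ (∑ k, p k) = 1 ∧
            (∑ k : Fin n, p k * (k.val : ℝ)) ≤ α},
          ⨅ δ ∈ Set.Ioi (0 : ℝ), ⨅ m ∈ Set.Ioi (0 : ℝ),
            ((dualityUB h v A α p δ m : ℝ) : EReal) := by
  rw [misoCapacity]
  refine iSup₂_le fun μ hμ => ?_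
  obtain ⟨hprob, hpeak, havg⟩ := hμ
  obtain ⟨p, hp0, hp1, hpα, hle⟩ :=
    exists_mutualInfo_le_dualityUB (by omega) hord hpos hv.ne' hA hpeak havg
  exact le_iSup₂_of_le p ⟨hp0, hp1, hpα⟩ (le_iInf₂ fun δ hδ => le_iInf₂ fun m hm => hle δ hδ m hm)
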